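/- Let α be a pattern such that for every prime number p (identified with the principal ultrafilter at p), Σ_k α(p,k) ≤ 1. Enumerate the support of α as (P_1,k_1),…,(P_r,k_r) with m_i = α(P_i,k_i), and let ℓ be any finite list whose entries are exactly m_i copies of the basic ultrafilter P_i^{k_i} for each i = 1,…,r, in any order. If F is the product of the entries of ℓ with respect to the extended multiplication on βℕ, then F_α ⊆ F. -/

import Mathlib

open scoped Classical

/-- The set of primes, as a subset of the positive integers. -/
def primes : Set ℕ+ := {p | (p : ℕ).Prime}

/-- A pattern assigns a multiplicity in `ω` to each pair `(P, k)` of an ultrafilter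
on `ℕ` and an exponent `k`, with finite support. -/
abbrev Pat : Type := ((Ultrafilter ℕ+) × ℕ) →₀ ℕ

/-- A pattern is only supported on pairs `(P, k)` where `ℙ ∈ P` and `k ≥ 1`. -/
def IsPattern (α : Pat) : Prop :=
  ∀ Pk ∈ α.support, primes ∈ Pk.1 ∧ 0 < Pk.2

/-- `σ(α) = Σ k·α(P,k)`. -/
def sigmaPat (α : Pat) : ℕ := ∑ Pk ∈ α.support, Pk.2 * α Pk

/-- Given a pattern `α` and a choice `A` of a set of primes for each ultrafilter,
the set `{∏_i ∏_j p_{i,j}^{k_i} : p_{i,j} ∈ A(P_i) pairwise distinct}`. -/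
def patBaseSet (α : Pat) (A : Ultrafilter ℕ+ → Set ℕ+) : Set ℕ+ :=
  { x | ∃ p : (Pk : (Ultrafilter ℕ+) × ℕ) → Fin (α Pk) → ℕ+,
      (∀ Pk j, p Pk j ∈ A Pk.1) ∧
      Function.Injective (fun q : Σ Pk : (Ultrafilter ℕ+) × ℕ, Fin (α Pk) => p q.1 q.2) ∧
      x = ∏ Pk ∈ α.support, ∏ j : Fin (α Pk), (p Pk j) ^ Pk.2 }

/-- The family `F_α`: all sets obtained from choices of sets `A(P) ∈ P`, `A(P) ⊆ ℙ`,
with `A(P) ∩ A(P') = ∅` for distinct `P, P'` occurring in the support of `α`. -/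
def FamF (α : Pat) : Set (Set ℕ+) :=
  { S | ∃ A : Ultrafilter ℕ+ → Set ℕ+,
      (∀ Pk ∈ α.support, A Pk.1 ∈ Pk.1 ∧ A Pk.1 ⊆ primes) ∧
      (∀ Pk ∈ α.support, ∀ Pk' ∈ α.support, Pk.1 ≠ Pk'.1 → A Pk.1 ∩ A Pk'.1 = ∅) ∧
      S = patBaseSet α A }

/-- The extension of multiplication to `βℕ`:
`A ∈ F·G` iff `{m : {n : m*n ∈ A} ∈ G} ∈ F`. -/
def umul (F G : Ultrafilter ℕ+) : Ultrafilter ℕ+ :=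
  F.bind fun m => Ultrafilter.map (fun n => m * n) G

/-- If every two entries of `L` meet the compatibility condition below, then the product of the
basic ultrafilters listed by `L` contains the set of products of distinct primes chosen along `L`
outside of the finite set `T`. -/
theorem mem_foldr_umul (A : Ultrafilter ℕ+ → Set ℕ+) (L : List (Ultrafilter ℕ+ × ℕ))
    (hA : ∀ a ∈ L, A a.1 ∈ a.1)
    (hL : L.Pairwise fun a b => ∀ t, t ∈ A a.1 → t ∈ A b.1 → {t} ∉ b.1)
    (T : Finset ℕ+) (hT : ∀ a ∈ L, ∀ t ∈ T, t ∈ A a.1 → {t} ∉ a.1) :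
    {x | ∃ Q : Finset (ℕ+ × (Ultrafilter ℕ+ × ℕ)),
      (∀ a, (Q.filter fun q => q.2 = a).card = L.count a) ∧
      (∀ q ∈ Q, q.1 ∈ A q.2.1 ∧ q.1 ∉ T) ∧
      Set.InjOn Prod.fst (Q : Set (ℕ+ × (Ultrafilter ℕ+ × ℕ))) ∧
      x = ∏ q ∈ Q, q.1 ^ q.2.2} ∈
    (L.map fun a => Ultrafilter.map (fun m => m ^ a.2) a.1).foldr umul (pure 1) := by
  induction L generalizing T with
  | nil =>
    simp only [List.map_nil, List.foldr_nil, Ultrafilter.mem_pure]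
    exact ⟨∅, by simp⟩
  | cons a L ih =>
    rw [List.pairwise_cons] at hL
    simp only [List.map_cons, List.foldr_cons]
    change {m | _ ∈ _} ∈ Ultrafilter.map _ a.1
    rw [Ultrafilter.mem_map]
    have hT' : (⋂ t ∈ T, {p | p ∈ A a.1 → p ≠ t}) ∈ (a.1 : Filter ℕ+) := by
      rw [Filter.biInter_finset_mem]
      intro t ht
      by_cases hta : t ∈ A a.1
      · filter_upwards [Ultrafilter.compl_mem_iff_notMem.2 (hT a (by simp) t ht hta)] with p hp _
        simpa using hp
      · filter_upwards with p hp h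
        exact hta (h ▸ hp)
    have hAa : A a.1 ∈ (a.1 : Filter ℕ+) := hA a (by simp)
    change _ ∈ (a.1 : Filter ℕ+)
    filter_upwards [hAa, hT'] with p hp hpT
    have hpT : p ∉ T := fun h => (Set.mem_iInter₂.1 hpT p h) hp rfl
    have key := ih (fun b hb => hA b (by simp [hb])) hL.2 (insert p T) (by
      intro b hb t ht htb
      rcases Finset.mem_insert.1 ht with rfl | ht
      · exact hL.1 b hb t hp htb
      · exact hT b (by simp [hb]) t ht htb)
    change _ ∈ Ultrafilter.map _ _
    rw [Ultrafilter.mem_map]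
    refine Filter.mem_of_superset key ?_
    rintro x ⟨Q, hc, hQ, hinj, rfl⟩
    have hnQ : ∀ q ∈ Q, q.1 ≠ p := fun q hq h => (hQ q hq).2 (by simp [h])
    have hmem : (p, a) ∉ Q := fun h => hnQ _ h rfl
    refine ⟨insert (p, a) Q, ?_, ?_, ?_, ?_⟩
    · intro b
      rw [Finset.filter_insert, List.count_cons, ← hc b]
      by_cases hab : a = b
      · subst hab
        simp [Finset.card_insert_of_notMem, hmem]
      · simp [hab]
    · intro q hq
      rcases Finset.mem_insert.1 hq with rfl | hq
      · exact ⟨hp, hpT⟩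
      · exact ⟨(hQ q hq).1, fun h => (hQ q hq).2 (by simp [h])⟩
    · rw [Finset.coe_insert, Set.injOn_insert (by simpa using hmem)]
      refine ⟨hinj, ?_⟩
      rintro ⟨q, hq, h⟩
      exact hnQ q hq h
    · rw [Finset.prod_insert hmem]

/-- A finite set of labelled primes with distinct primes and with `α a` primes labelled `a`
yields an element of `patBaseSet α A`. -/
theorem prod_mem_patBaseSet (α : Pat) (A : Ultrafilter ℕ+ → Set ℕ+)
    (Q : Finset (ℕ+ × (Ultrafilter ℕ+ × ℕ)))
    (hc : ∀ a, (Q.filter fun q => q.2 = a).card = α a)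
    (hQ : ∀ q ∈ Q, q.1 ∈ A q.2.1)
    (hinj : Set.InjOn Prod.fst (Q : Set (ℕ+ × (Ultrafilter ℕ+ × ℕ)))) :
    ∏ q ∈ Q, q.1 ^ q.2.2 ∈ patBaseSet α A := by
  let e : ∀ a, Fin (α a) ≃ Q.filter fun q => q.2 = a := fun a =>
    (Finset.equivFinOfCardEq (hc a)).symm
  have he : ∀ a j, (e a j).1 ∈ Q ∧ (e a j).1.2 = a := fun a j =>
    Finset.mem_filter.1 (e a j).2
  refine ⟨fun a j => (e a j).1.1, ?_, ?_, ?_⟩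
  · intro a j
    have := hQ _ (he a j).1
    rwa [(he a j).2] at this
  · rintro ⟨a, i⟩ ⟨b, j⟩ h
    have h := hinj (he a i).1 (he b j).1 h
    obtain rfl : a = b := by rw [← (he a i).2, ← (he b j).2, h]
    rw [(e a).injective (Subtype.ext h)]
  · rw [← Finset.prod_fiberwise_of_maps_to (g := Prod.snd) (t := α.support)]
    · refine Finset.prod_congr rfl fun a _ => ?_
      rw [← Finset.prod_coe_sort, ← (e a).prod_comp]
      exact Finset.prod_congr rfl fun j _ => by rw [(he a j).2]
    · intro q hq
      rw [Finsupp.mem_support_iff, ← hc, Finset.card_ne_zero]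
      exact ⟨q, by simp [hq]⟩

/-- A list that enumerates the image of a multiset lifts to an enumeration of the multiset. -/
theorem exists_list_map_eq {β γ : Type*} (f : β → γ) (l : List γ) (s : Multiset β)
    (h : (l : Multiset γ) = s.map f) : ∃ L : List β, (L : Multiset β) = s ∧ L.map f = l := by
  induction l generalizing s with
  | nil =>
    exact ⟨[], by simpa [eq_comm] using h⟩
  | cons c l ih =>
    rw [← Multiset.cons_coe, eq_comm, ← Multiset.map_eq_cons] at h
    obtain ⟨b, hb, rfl, h⟩ := h
    obtain ⟨L, hL, rfl⟩ := ih _ h.symm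
    exact ⟨b :: L, by rw [← Multiset.cons_coe, hL, Multiset.cons_erase hb], rfl⟩

/-- In an enumeration of a pattern with `Σ_k α(p,k) ≤ 1` for all primes `p`, no principal
ultrafilter occurs twice, so that entries are compatible in the sense of `mem_foldr_umul`. -/
theorem pairwise_of_sum_le_one (α : Pat)
    (hsimple : ∀ p : ℕ+, (p : ℕ).Prime →
      (∑ Pk ∈ α.support.filter (fun Pk => Pk.1 = pure p), α Pk) ≤ 1)
    (A : Ultrafilter ℕ+ → Set ℕ+) (hA : ∀ a ∈ α.support, A a.1 ⊆ primes)
    (hd : ∀ a ∈ α.support, ∀ b ∈ α.support, a.1 ≠ b.1 → A a.1 ∩ A b.1 = ∅)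
    (L : List (Ultrafilter ℕ+ × ℕ)) (hc : ∀ a, L.count a = α a) :
    L.Pairwise fun a b => ∀ t, t ∈ A a.1 → t ∈ A b.1 → {t} ∉ b.1 := by
  rw [List.pairwise_iff_forall_sublist]
  intro a b hab t hta htb ht
  have hs : ∀ c ∈ [a, b], c ∈ α.support := fun c hc' => by
    rw [Finsupp.mem_support_iff, ← hc]
    exact (List.count_pos_iff.2 (hab.subset hc')).ne'
  have ha := hs a (by simp)
  have hb := hs b (by simp)
  have hbt : b.1 = pure t := by
    obtain ⟨x, hx, h⟩ := Ultrafilter.eq_pure_of_finite_mem (Set.finite_singleton t) ht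
    rwa [Set.mem_singleton_iff.1 hx] at h
  have heq : a.1 = b.1 := by
    by_contra hne
    have := hd a ha b hb hne
    exact (this ▸ (⟨hta, htb⟩ : t ∈ A a.1 ∩ A b.1) : t ∈ (∅ : Set ℕ+))
  have hle := hsimple t (hA a ha hta)
  have hsum : ∑ c ∈ {a, b}, α c ≤ 1 := by
    refine (Finset.sum_le_sum_of_subset ?_).trans hle
    intro c hc'
    simp only [Finset.mem_insert, Finset.mem_singleton] at hc'
    rcases hc' with rfl | rfl
    · exact Finset.mem_filter.2 ⟨ha, heq.trans hbt⟩
    · exact Finset.mem_filter.2 ⟨hb, hbt⟩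
  by_cases h : a = b
  · subst h
    have := hab.count_le a
    rw [hc] at this
    simp at this hsum
    omega
  · rw [Finset.sum_pair h] at hsum
    have := Nat.pos_of_ne_zero (Finsupp.mem_support_iff.1 ha)
    have := Nat.pos_of_ne_zero (Finsupp.mem_support_iff.1 hb)
    omega

theorem stmt9 (α : Pat) (hα : IsPattern α)
    -- for every prime `p`, `Σ_k α(p,k) ≤ 1`
    (hsimple : ∀ p : ℕ+, (p : ℕ).Prime →
      (∑ Pk ∈ α.support.filter (fun Pk => Pk.1 = pure p), α Pk) ≤ 1)
    -- `ℓ` is a list whose entries are exactly `α(P,k)` copies of the basic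
    -- ultrafilter `P^k` (the image of `P` under `m ↦ m^k`) for each `(P,k)`:
    (ℓ : List (Ultrafilter ℕ+))
    (hℓ : (ℓ : Multiset (Ultrafilter ℕ+)) =
      ∑ Pk ∈ α.support,
        Multiset.replicate (α Pk) (Ultrafilter.map (fun m => m ^ Pk.2) Pk.1))
    -- `F` is the product of the entries of `ℓ` (in order) with respect to
    -- the extended multiplication (the principal ultrafilter at 1 is its unit):
    (F : Ultrafilter ℕ+) (hF : F = ℓ.foldr umul (pure 1)) :
    ∀ S ∈ FamF α, S ∈ F := by
  rintro S ⟨A, hA, hd, rfl⟩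
  obtain ⟨L, hL, rfl⟩ := exists_list_map_eq
    (fun a : Ultrafilter ℕ+ × ℕ => Ultrafilter.map (fun m => m ^ a.2) a.1) ℓ
    (∑ a ∈ α.support, Multiset.replicate (α a) a) (by
      rw [hℓ, ← Multiset.coe_mapAddMonoidHom, map_sum]
      simp)
  have hc : ∀ a, L.count a = α a := fun a => by
    have h : L.count a = (L : Multiset _).count a := by
      rw [Multiset.coe_count]
      exact List.countP_congr fun b _ => by simp
    rw [h, hL, Multiset.count_sum']
    simp +contextual [Multiset.count_replicate, eq_comm]
  have hs : ∀ a ∈ L, a ∈ α.support := fun a ha => by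
    rw [Finsupp.mem_support_iff, ← hc]
    exact (List.count_pos_iff.2 ha).ne'
  rw [hF]
  refine Filter.mem_of_superset (mem_foldr_umul A L (fun a ha => (hA a (hs a ha)).1)
    (pairwise_of_sum_le_one α hsimple A (fun a ha => (hA a ha).2) hd L hc) ∅ (by simp)) ?_
  rintro x ⟨Q, hcQ, hQ, hinj, rfl⟩
  exact prod_mem_patBaseSet α A Q (fun a => (hcQ a).trans (hc a)) (fun q hq => (hQ q hq).1) hinj
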